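/- arXiv:2505.14063 — 4 statements merged into one kernel-verified Lean document; each statement's English description precedes it below -/
import Mathlib

section
/- Let k ≥ 1 and let x^⊥ denote the polynomial vector field (x_2, −x_1) in two variables. Then the multiplication map q ↦ x^⊥ q = (x_2 q, −x_1 q) is injective on P_{k−1}^2, and the space (P_k^2)^2 decomposes as the direct sum (P_k^2)^2 = ∇P_{k+1}^2 ⊕ x^⊥ P_{k−1}^2, where x^⊥ P_{k−1}^2 = { x^⊥ q : q ∈ P_{k−1}^2 }. -/
open MvPolynomial

/-- The gradient map `p ↦ (∂p/∂x_1, ∂p/∂x_2)` on polynomials in two variables,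
as an `ℝ`-linear map. -/
noncomputable def gradMap2 :
    MvPolynomial (Fin 2) ℝ →ₗ[ℝ] (Fin 2 → MvPolynomial (Fin 2) ℝ) :=
  LinearMap.pi fun i => (MvPolynomial.pderiv i).toLinearMap

/-- The polynomial vector field `x^⊥ = (x_2, −x_1)` in two variables. -/
noncomputable def xPerp : Fin 2 → MvPolynomial (Fin 2) ℝ :=
  ![X 1, -X 0]

/-- The multiplication map `q ↦ x^⊥ q = (x_2 q, −x_1 q)`, as an `ℝ`-linear map. -/
noncomputable def mulXPerp :
    MvPolynomial (Fin 2) ℝ →ₗ[ℝ] (Fin 2 → MvPolynomial (Fin 2) ℝ) :=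
  LinearMap.pi fun i => LinearMap.mulLeft ℝ (xPerp i)

/-- Euler's operator multiplies the coefficient of each monomial by its degree. -/
lemma MvPolynomial.coeff_sum_X_mul_pderiv {σ R : Type*} [Fintype σ] [CommSemiring R]
    (p : MvPolynomial σ R) (m : σ →₀ ℕ) :
    coeff m (∑ i, X i * pderiv i p) = m.degree * coeff m p := by
  classical
  induction p using MvPolynomial.induction_on' with
  | add p q hp hq => simp only [map_add, mul_add, Finset.sum_add_distrib, coeff_add, hp, hq]
  | monomial n a =>
    simp only [X_mul_pderiv_monomial, ← Finset.sum_smul, ← Finsupp.degree_eq_sum]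
    rw [coeff_smul, coeff_monomial, nsmul_eq_mul]
    split_ifs with h <;> simp [h]

/-- A polynomial annihilated by Euler's operator has vanishing partial derivatives. -/
lemma MvPolynomial.pderiv_eq_zero_of_sum_X_mul_pderiv_eq_zero {σ R : Type*} [Fintype σ]
    [CommSemiring R] [NoZeroDivisors R] [CharZero R] {p : MvPolynomial σ R}
    (h : ∑ i, X i * pderiv i p = 0) (i : σ) : pderiv i p = 0 := by
  ext m
  have hm := coeff_sum_X_mul_pderiv p (m + Finsupp.single i 1)
  rw [h, coeff_zero, eq_comm, mul_eq_zero, Nat.cast_eq_zero] at hm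
  rw [coeff_pderiv, coeff_zero, hm.resolve_left (by simp), zero_mul]

/-- Euler's operator is onto the polynomials without constant term, and its preimages can be
chosen of no larger degree. -/
lemma MvPolynomial.exists_sum_X_mul_pderiv_eq {σ K : Type*} [Fintype σ] [Field K] [CharZero K]
    {g : MvPolynomial σ K} (hg : coeff 0 g = 0) :
    ∃ p : MvPolynomial σ K, p.totalDegree ≤ g.totalDegree ∧ ∑ i, X i * pderiv i p = g := by
  classical
  refine ⟨∑ m ∈ g.support, monomial m ((m.degree : K)⁻¹ * coeff m g),
    totalDegree_finsetSum_le fun m hm ↦ (totalDegree_monomial_le _ _).trans (le_totalDegree hm),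
    ?_⟩
  ext m
  rw [coeff_sum_X_mul_pderiv]
  simp only [coeff_sum, coeff_monomial, Finset.sum_ite_eq', mem_support_iff]
  split_ifs with h
  · have hm : (m.degree : K) ≠ 0 := by
      rw [Nat.cast_ne_zero, Ne, Finsupp.degree_eq_zero_iff]
      rintro rfl
      exact h hg
    exact mul_inv_cancel_left₀ hm _
  · rw [mul_zero, eq_comm]
    exact not_not.mp h

lemma MvPolynomial.totalDegree_pderiv_le {σ R : Type*} [CommSemiring R] (i : σ)
    (p : MvPolynomial σ R) : (pderiv i p).totalDegree ≤ p.totalDegree - 1 := by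
  refine Finset.sup_le fun m hm ↦ ?_
  rw [mem_support_iff, coeff_pderiv] at hm
  have h := le_totalDegree (mem_support_iff.mpr (left_ne_zero_of_mul hm))
  rw [Finsupp.sum_add_index' (by simp) (by simp), Finsupp.sum_single_index rfl] at h
  lia

/-- The polynomial vector fields pointwise orthogonal to the position vector are the multiples of
`xPerp`. -/
lemma exists_mulXPerp_eq {G : Fin 2 → MvPolynomial (Fin 2) ℝ} (hG : ∑ i, X i * G i = 0) :
    ∃ q, mulXPerp q = G := by
  rw [Fin.sum_univ_two] at hG
  have hX : ¬(X 1 : MvPolynomial (Fin 2) ℝ) ∣ X 0 := by simp [X_dvd_X]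
  obtain ⟨q, hq⟩ : X 1 ∣ G 0 :=
    (X_prime.dvd_or_dvd ⟨-G 1, by linear_combination hG⟩).resolve_left hX
  refine ⟨q, ?_⟩
  ext1 i
  fin_cases i
  · simp [mulXPerp, xPerp, hq]
  · refine mul_left_cancel₀ (X_ne_zero (R := ℝ) (1 : Fin 2)) ?_
    simp only [mulXPerp, xPerp, LinearMap.pi_apply, LinearMap.mulLeft_apply, Fin.mk_one,
      Matrix.cons_val_one, Matrix.cons_val_fin_one]
    linear_combination -hG + X 0 * hq

lemma sum_X_mul_mulXPerp (q : MvPolynomial (Fin 2) ℝ) : ∑ i, X i * mulXPerp q i = 0 := by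
  simp only [Fin.sum_univ_two, mulXPerp, xPerp, LinearMap.pi_apply, LinearMap.mulLeft_apply,
    Matrix.cons_val_zero, Matrix.cons_val_one, Matrix.cons_val_fin_one]
  ring

lemma totalDegree_xPerp (i : Fin 2) : (xPerp i).totalDegree = 1 := by
  fin_cases i <;> simp [xPerp]

lemma mulXPerp_injective : Function.Injective mulXPerp := fun _ _ h ↦
  mul_left_cancel₀ (X_ne_zero (R := ℝ) (1 : Fin 2)) (congr_fun h 0)

/-- Let `k ≥ 1` and `x^⊥ = (x_2, −x_1)`.  The map `q ↦ x^⊥ q` is injective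
on `P_{k−1}^2`, and `(P_k^2)^2 = ∇P_{k+1}^2 ⊕ x^⊥ P_{k−1}^2` (direct sum). -/
theorem xperp_decomposition (k : ℕ) (hk : 1 ≤ k) :
    Set.InjOn mulXPerp (MvPolynomial.restrictTotalDegree (Fin 2) ℝ (k - 1) : Set _) ∧
    (Submodule.map gradMap2 (MvPolynomial.restrictTotalDegree (Fin 2) ℝ (k + 1)) ⊔
      Submodule.map mulXPerp (MvPolynomial.restrictTotalDegree (Fin 2) ℝ (k - 1)) =
      Submodule.pi Set.univ
        (fun _ : Fin 2 => MvPolynomial.restrictTotalDegree (Fin 2) ℝ k)) ∧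
    (Submodule.map gradMap2 (MvPolynomial.restrictTotalDegree (Fin 2) ℝ (k + 1)) ⊓
      Submodule.map mulXPerp (MvPolynomial.restrictTotalDegree (Fin 2) ℝ (k - 1)) = ⊥) := by
  refine ⟨mulXPerp_injective.injOn, le_antisymm (sup_le ?_ ?_) fun F hF ↦ ?_, ?_⟩
  · rintro _ ⟨p, hp, rfl⟩ i -
    rw [SetLike.mem_coe, mem_restrictTotalDegree] at hp ⊢
    exact (totalDegree_pderiv_le i p).trans (by lia)
  · rintro _ ⟨q, hq, rfl⟩ i -
    rw [SetLike.mem_coe, mem_restrictTotalDegree] at hq ⊢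
    refine (totalDegree_mul (xPerp i) q).trans ?_
    rw [totalDegree_xPerp]
    lia
  · have hFk (i) : (F i).totalDegree ≤ k :=
      (mem_restrictTotalDegree _ _ _).mp (hF i (Set.mem_univ i))
    obtain ⟨p, hp, hpF⟩ := exists_sum_X_mul_pderiv_eq (g := ∑ i, X i * F i)
      (by simp [coeff_X_mul'])
    replace hp : p.totalDegree ≤ k + 1 := by
      refine hp.trans (totalDegree_finsetSum_le fun i _ ↦ (totalDegree_mul _ _).trans ?_)
      rw [totalDegree_X]
      have := hFk i
      lia
    obtain ⟨q, hq⟩ := exists_mulXPerp_eq (G := F - gradMap2 p) (by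
      simp only [Pi.sub_apply, mul_sub, Finset.sum_sub_distrib, ← hpF]
      exact sub_self _)
    refine Submodule.mem_sup.mpr ⟨gradMap2 p, ⟨p, (mem_restrictTotalDegree _ _ _).mpr hp, rfl⟩,
      mulXPerp q, ⟨q, (mem_restrictTotalDegree _ _ _).mpr ?_, rfl⟩, by rw [hq]; abel⟩
    obtain rfl | hq0 := eq_or_ne q 0
    · simp
    have hq1 : X 1 * q = F 0 - pderiv 0 p := congr_fun hq 0
    have hdeg : (X 1 * q).totalDegree ≤ k :=
      hq1 ▸ (totalDegree_sub _ _).trans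
        (max_le (hFk 0) ((totalDegree_pderiv_le 0 p).trans (by lia)))
    rw [totalDegree_mul_of_isDomain (X_ne_zero _) hq0, totalDegree_X] at hdeg
    lia
  · rw [eq_bot_iff]
    rintro _ ⟨⟨p, -, rfl⟩, q, -, hq⟩
    have h := sum_X_mul_mulXPerp q
    rw [hq] at h
    exact funext (pderiv_eq_zero_of_sum_X_mul_pderiv_eq_zero h)
end

section
/- Let k ≥ 1 and let x = (x_1, x_2, x_3) denote the identity polynomial vector field in three variables. Then the space (P_k^3)^3 decomposes as the direct sum (P_k^3)^3 = ∇P_{k+1}^3 ⊕ (x ∧ (P_{k−1}^3)^3), where x ∧ (P_{k−1}^3)^3 = { x × v : v ∈ (P_{k−1}^3)^3 } is the space of cross products of x with vectors of polynomials of degree at most k−1. -/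
open MvPolynomial

/-- The gradient map `p ↦ (∂p/∂x_1, ∂p/∂x_2, ∂p/∂x_3)` on polynomials in three variables,
as an `ℝ`-linear map. -/
noncomputable def gradMap3 :
    MvPolynomial (Fin 3) ℝ →ₗ[ℝ] (Fin 3 → MvPolynomial (Fin 3) ℝ) :=
  LinearMap.pi fun i => (MvPolynomial.pderiv i).toLinearMap

/-- The identity polynomial vector field `x = (x_1, x_2, x_3)` in three variables. -/
noncomputable def xId : Fin 3 → MvPolynomial (Fin 3) ℝ :=
  ![X 0, X 1, X 2]

/-- The map `v ↦ x × v` (entrywise cross product with the identity vector field),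
as an `ℝ`-linear map on 3-vectors of polynomials. -/
noncomputable def crossWithX :
    (Fin 3 → MvPolynomial (Fin 3) ℝ) →ₗ[ℝ] (Fin 3 → MvPolynomial (Fin 3) ℝ) :=
  LinearMap.restrictScalars ℝ (crossProduct xId)

namespace MvPolynomial

variable {σ R : Type*} [CommSemiring R]

lemma totalDegree_pderiv_le_s5 (i : σ) (p : MvPolynomial σ R) :
    (pderiv i p).totalDegree ≤ p.totalDegree - 1 := by
  refine Finset.sup_le fun m hm => ?_
  have hm' : m + Finsupp.single i 1 ∈ p.support := by
    rw [mem_support_iff, coeff_pderiv] at hm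
    exact mem_support_iff.mpr (left_ne_zero_of_mul hm)
  have h := le_totalDegree hm'
  rw [Finsupp.sum_add_index' (fun _ => rfl) (fun _ _ _ => rfl),
    Finsupp.sum_single_index rfl] at h
  omega

lemma coeff_X_mul_pderiv (i : σ) (p : MvPolynomial σ R) (m : σ →₀ ℕ) :
    coeff m (X i * pderiv i p) = m i * coeff m p := by
  classical
  induction p using MvPolynomial.induction_on' with
  | add p q hp hq => simp [hp, hq, mul_add]
  | monomial n a =>
    rw [X_mul_pderiv_monomial, coeff_smul, coeff_monomial, nsmul_eq_mul]
    split_ifs with h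
    · rw [h]
    · simp

lemma pderiv_eq_zero_of_sum_X_mul_pderiv_eq_zero_s5 [Fintype σ] [NoZeroDivisors R] [CharZero R]
    {p : MvPolynomial σ R} (h : ∑ i, X i * pderiv i p = 0) (i : σ) : pderiv i p = 0 := by
  ext m
  have hc := congrArg (coeff (m + Finsupp.single i 1)) h
  simp only [coeff_sum, coeff_X_mul_pderiv, coeff_zero, ← Finset.sum_mul] at hc
  rw [coeff_pderiv, coeff_zero]
  rcases mul_eq_zero.mp hc with hs | hs
  · have hs' : ∑ j, (m + Finsupp.single i 1 : σ →₀ ℕ) j = 0 := by exact_mod_cast hs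
    have hi := Finset.sum_eq_zero_iff.mp hs' i (Finset.mem_univ i)
    simp at hi
  · rw [hs, zero_mul]

lemma sum_range_homogeneousComponent {p : MvPolynomial σ R} {k : ℕ} (hp : p.totalDegree ≤ k) :
    ∑ n ∈ Finset.range (k + 1), homogeneousComponent n p = p := by
  conv_rhs => rw [← sum_homogeneousComponent p]
  refine (Finset.sum_subset (Finset.range_mono (by omega)) fun n _ hn => ?_).symm
  exact homogeneousComponent_eq_zero n p (by simpa using hn)

end MvPolynomial

/-- The curl of a polynomial vector field in three variables. -/
noncomputable def curl3 (w : Fin 3 → MvPolynomial (Fin 3) ℝ) :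
    Fin 3 → MvPolynomial (Fin 3) ℝ :=
  ![pderiv 1 (w 2) - pderiv 2 (w 1), pderiv 2 (w 0) - pderiv 0 (w 2),
    pderiv 0 (w 1) - pderiv 1 (w 0)]

lemma crossWithX_apply (v : Fin 3 → MvPolynomial (Fin 3) ℝ) :
    crossWithX v = ![X 1 * v 2 - X 2 * v 1, X 2 * v 0 - X 0 * v 2, X 0 * v 1 - X 1 * v 0] := by
  change crossProduct xId v = _
  rw [cross_apply]
  rfl

/-- For a homogeneous field `w` of degree `n`, `∇(x · w) - x × curl w = (n + 1) w`. -/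
lemma gradMap3_sub_crossWithX_curl3 {n : ℕ} {w : Fin 3 → MvPolynomial (Fin 3) ℝ}
    (hw : ∀ i, (w i).IsHomogeneous n) :
    gradMap3 (∑ i, X i * w i) - crossWithX (curl3 w) = ((n : ℝ) + 1) • w := by
  have euler i := (hw i).sum_X_mul_pderiv
  simp only [Fin.sum_univ_three, nsmul_eq_mul] at euler
  funext i
  have h : (((n : ℝ) + 1) • w) i = (n : MvPolynomial (Fin 3) ℝ) * w i + w i := by
    simp [add_smul, Nat.cast_smul_eq_nsmul]
  rw [h, ← euler i, crossWithX_apply]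
  fin_cases i <;>
    simp [gradMap3, curl3, Fin.sum_univ_three, pderiv_X] <;> ring

lemma curl3_totalDegree_le {w : Fin 3 → MvPolynomial (Fin 3) ℝ} {k : ℕ}
    (hw : ∀ i, (w i).totalDegree ≤ k) (i : Fin 3) : (curl3 w i).totalDegree ≤ k - 1 := by
  have h a b : (pderiv a (w b)).totalDegree ≤ k - 1 :=
    (totalDegree_pderiv_le_s5 a (w b)).trans (Nat.sub_le_sub_right (hw b) 1)
  fin_cases i <;> exact (totalDegree_sub _ _).trans (max_le (h _ _) (h _ _))

lemma crossWithX_totalDegree_le {v : Fin 3 → MvPolynomial (Fin 3) ℝ} {k : ℕ}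
    (hv : ∀ i, (v i).totalDegree ≤ k) (i : Fin 3) : (crossWithX v i).totalDegree ≤ k + 1 := by
  have h (a b : Fin 3) : (X a * v b).totalDegree ≤ k + 1 := by
    refine (totalDegree_mul _ _).trans ?_
    rw [totalDegree_X, add_comm]
    exact Nat.add_le_add_right (hv b) 1
  rw [crossWithX_apply]
  fin_cases i <;> exact (totalDegree_sub _ _).trans (max_le (h _ _) (h _ _))

lemma sum_X_mul_crossWithX (v : Fin 3 → MvPolynomial (Fin 3) ℝ) :
    ∑ i, X i * crossWithX v i = 0 := by
  rw [crossWithX_apply, Fin.sum_univ_three]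
  simp only [Matrix.cons_val]
  ring

/-- Let `k ≥ 1` and let `x = (x_1, x_2, x_3)` be the identity polynomial
vector field.  Then `(P_k^3)^3 = ∇P_{k+1}^3 ⊕ (x ∧ (P_{k−1}^3)^3)` (direct sum), where
`x ∧ (P_{k−1}^3)^3 = { x × v : v ∈ (P_{k−1}^3)^3 }`. -/
theorem cross_decomposition (k : ℕ) (hk : 1 ≤ k) :
    (Submodule.map gradMap3 (MvPolynomial.restrictTotalDegree (Fin 3) ℝ (k + 1)) ⊔
      Submodule.map crossWithX
        (Submodule.pi Set.univ
          (fun _ : Fin 3 => MvPolynomial.restrictTotalDegree (Fin 3) ℝ (k - 1))) =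
      Submodule.pi Set.univ
        (fun _ : Fin 3 => MvPolynomial.restrictTotalDegree (Fin 3) ℝ k)) ∧
    (Submodule.map gradMap3 (MvPolynomial.restrictTotalDegree (Fin 3) ℝ (k + 1)) ⊓
      Submodule.map crossWithX
        (Submodule.pi Set.univ
          (fun _ : Fin 3 => MvPolynomial.restrictTotalDegree (Fin 3) ℝ (k - 1))) = ⊥) := by
  constructor
  · apply le_antisymm
    · refine sup_le ?_ ?_ <;> rw [Submodule.map_le_iff_le_comap]
      · intro p hp
        rw [mem_restrictTotalDegree] at hp
        refine Submodule.mem_pi.mpr fun i _ => (mem_restrictTotalDegree _ _ _).mpr ?_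
        exact (totalDegree_pderiv_le_s5 i p).trans (by omega)
      · intro v hv
        simp only [Submodule.mem_pi, Set.mem_univ, true_imp_iff, mem_restrictTotalDegree] at hv
        refine Submodule.mem_pi.mpr fun i _ => (mem_restrictTotalDegree _ _ _).mpr ?_
        exact (crossWithX_totalDegree_le hv i).trans (by omega)
    · intro w hw
      simp only [Submodule.mem_pi, Set.mem_univ, true_imp_iff, mem_restrictTotalDegree] at hw
      have hsum : ∑ n ∈ Finset.range (k + 1), (fun i => homogeneousComponent n (w i)) = w := by
        funext i
        rw [Finset.sum_apply]
        exact sum_range_homogeneousComponent (hw i)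
      rw [← hsum]
      refine Submodule.sum_mem _ fun n hn => ?_
      have hnk : n ≤ k := Nat.lt_succ_iff.mp (Finset.mem_range.mp hn)
      have hom i : (homogeneousComponent n (w i)).IsHomogeneous n :=
        homogeneousComponent_isHomogeneous n (w i)
      have hdeg i : (homogeneousComponent n (w i)).totalDegree ≤ k :=
        (hom i).totalDegree_le.trans hnk
      rw [← Submodule.smul_mem_iff _ (Nat.cast_add_one_ne_zero n : (n : ℝ) + 1 ≠ 0),
        ← gradMap3_sub_crossWithX_curl3 hom]
      refine Submodule.sub_mem _ (Submodule.mem_sup_left (Submodule.mem_map_of_mem ?_))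
        (Submodule.mem_sup_right (Submodule.mem_map_of_mem ?_))
      · refine Submodule.sum_mem _ fun i _ => (mem_restrictTotalDegree _ _ _).mpr ?_
        refine (totalDegree_mul _ _).trans ?_
        rw [totalDegree_X, add_comm]
        exact Nat.add_le_add_right (hdeg i) 1
      · exact Submodule.mem_pi.mpr fun i _ =>
          (mem_restrictTotalDegree _ _ _).mpr (curl3_totalDegree_le hdeg i)
  · rw [Submodule.eq_bot_iff]
    rintro _ ⟨⟨p, -, rfl⟩, ⟨v, -, hv⟩⟩
    have h : ∑ i, X i * pderiv i p = 0 := by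
      rw [← sum_X_mul_crossWithX v, hv]
      rfl
    funext i
    exact pderiv_eq_zero_of_sum_X_mul_pderiv_eq_zero_s5 h i
end

section
/- Let V be a real vector space, a : V × V → ℝ a symmetric positive semidefinite bilinear form, P ⊆ V a subspace, Π : V → V a linear map with range contained in P such that a(u − Πu, p) = 0 for all u ∈ V, p ∈ P, and such that Πp = p for all p ∈ P. Let S : V × V → ℝ be any bilinear form, and define a_h(u, v) = a(Πu, Πv) + S(u − Πu, v − Πv). Then a_h is consistent: a_h(p, v) = a(p, v) for every p ∈ P and every v ∈ V. -/
/-- Let `V` be a real vector space, `a` a symmetric positive semidefinite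
bilinear form, `P ⊆ V` a subspace, `Π : V → V` a linear map with range contained in `P`,
`a`-orthogonal onto `P` and fixing `P` pointwise.  Let `S` be any bilinear form and define
`a_h(u, v) = a(Πu, Πv) + S(u − Πu, v − Πv)`.  Then `a_h` is consistent:
`a_h(p, v) = a(p, v)` for every `p ∈ P` and every `v ∈ V`. -/
theorem discrete_form_consistency {V : Type*} [AddCommGroup V] [Module ℝ V]
    (a : V →ₗ[ℝ] V →ₗ[ℝ] ℝ)
    (hsymm : ∀ u v : V, a u v = a v u)
    (hpsd : ∀ v : V, 0 ≤ a v v)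
    (P : Submodule ℝ V)
    (proj : V →ₗ[ℝ] V)
    (hrange : ∀ u : V, proj u ∈ P)
    (horth : ∀ u : V, ∀ p ∈ P, a (u - proj u) p = 0)
    (hfix : ∀ p ∈ P, proj p = p)
    (S : V →ₗ[ℝ] V →ₗ[ℝ] ℝ)
    (ah : V → V → ℝ)
    (hah : ∀ u v : V, ah u v = a (proj u) (proj v) + S (u - proj u) (v - proj v)) :
    ∀ p ∈ P, ∀ v : V, ah p v = a p v := by
  intro p hp v
  have h := horth v p hp
  rw [map_sub, LinearMap.sub_apply, sub_eq_zero] at h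
  rw [hah, hfix p hp, sub_self, map_zero, LinearMap.zero_apply, add_zero,
    hsymm p (proj v), ← h, hsymm v p]
end

section
/- Let V be a real vector space, a : V × V → ℝ a symmetric positive semidefinite bilinear form, P ⊆ V a subspace, Π : V → V a linear map with range contained in P such that a(u − Πu, p) = 0 for all u ∈ V, p ∈ P, and such that Πp = p for all p ∈ P. Let S : V × V → ℝ be a symmetric positive semidefinite bilinear form for which there exist constants α_* > 0 and α^* > 0 with α_* a(w, w) ≤ S(w, w) ≤ α^* a(w, w) for every w ∈ V with Πw = 0. Define a_h(u, v) = a(Πu, Πv) + S(u − Πu, v − Πv). Then a_h is stable: min(1, α_*) a(v, v) ≤ a_h(v, v) ≤ max(1, α^*) a(v, v) for every v ∈ V. -/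
/-- Let `V` be a real vector space, `a` a symmetric positive semidefinite
bilinear form, `P ⊆ V` a subspace, `Π : V → V` a linear map with range contained in `P`,
`a`-orthogonal onto `P` and fixing `P` pointwise.  Let `S` be a symmetric positive
semidefinite bilinear form such that for some constants `α_* > 0`, `α^* > 0`,
`α_* a(w,w) ≤ S(w,w) ≤ α^* a(w,w)` whenever `Πw = 0`.  Define
`a_h(u, v) = a(Πu, Πv) + S(u − Πu, v − Πv)`.  Then `a_h` is stable:
`min(1, α_*) a(v,v) ≤ a_h(v,v) ≤ max(1, α^*) a(v,v)` for every `v ∈ V`. -/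
theorem discrete_form_stability {V : Type*} [AddCommGroup V] [Module ℝ V]
    (a : V →ₗ[ℝ] V →ₗ[ℝ] ℝ)
    (hsymm : ∀ u v : V, a u v = a v u)
    (hpsd : ∀ v : V, 0 ≤ a v v)
    (P : Submodule ℝ V)
    (proj : V →ₗ[ℝ] V)
    (hrange : ∀ u : V, proj u ∈ P)
    (horth : ∀ u : V, ∀ p ∈ P, a (u - proj u) p = 0)
    (hfix : ∀ p ∈ P, proj p = p)
    (S : V →ₗ[ℝ] V →ₗ[ℝ] ℝ)
    (hSsymm : ∀ u v : V, S u v = S v u)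
    (hSpsd : ∀ v : V, 0 ≤ S v v)
    (αl αu : ℝ) (hαl : 0 < αl) (hαu : 0 < αu)
    (hstab : ∀ w : V, proj w = 0 → αl * a w w ≤ S w w ∧ S w w ≤ αu * a w w)
    (ah : V → V → ℝ)
    (hah : ∀ u v : V, ah u v = a (proj u) (proj v) + S (u - proj u) (v - proj v)) :
    ∀ v : V, min 1 αl * a v v ≤ ah v v ∧ ah v v ≤ max 1 αu * a v v := by
  intro v
  have hker : proj (v - proj v) = 0 := by
    rw [map_sub, hfix _ (hrange v), sub_self]
  have hpyth : a v v = a (proj v) (proj v) + a (v - proj v) (v - proj v) := by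
    have h₁ := horth v _ (hrange v)
    have h₂ := hsymm (proj v) v
    simp only [map_sub, LinearMap.sub_apply] at h₁ ⊢
    linarith
  obtain ⟨hlower, hupper⟩ := hstab _ hker
  have hp := hpsd (proj v)
  have hw := hpsd (v - proj v)
  rw [hah, hpyth, mul_add, mul_add]
  constructor
  · exact add_le_add (mul_le_of_le_one_left hp (min_le_left _ _))
      ((mul_le_mul_of_nonneg_right (min_le_right _ _) hw).trans hlower)
  · exact add_le_add (le_mul_of_one_le_left hp (le_max_left _ _))
      (hupper.trans (mul_le_mul_of_nonneg_right (le_max_right _ _) hw))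
end
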